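/- Let g ∈ C^{p+1}[−1,1] and let g_N denote the N-th partial sum of its Fourier–Legendre series. Then there is a constant c_{p+1}, independent of g and N, such that for all N > p+1, max_{[−1,1]}|g − g_N| ≤ c_{p+1}·M_g / N^{p+1/2}, where M_g = max_{[−1,1]} |g^{(p+1)}|. -/

import Mathlib

open Polynomial MeasureTheory intervalIntegral

/-- Legendre polynomials via Bonnet recursion. -/
noncomputable def legendre : ℕ → Polynomial ℝ
  | 0 => 1
  | 1 => X
  | (n + 2) => C ((2 * (n:ℝ) + 3) / ((n:ℝ) + 2)) * X * legendre (n + 1)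
      - C (((n:ℝ) + 1) / ((n:ℝ) + 2)) * legendre n

theorem legendre_bonnet (n : ℕ) : ((n : ℝ[X]) + 2) * legendre (n + 2) =
    (2 * (n : ℝ[X]) + 3) * X * legendre (n + 1) - ((n : ℝ[X]) + 1) * legendre n := by
  have hn : (n : ℝ) + 2 ≠ 0 := by positivity
  have h1 : ((n : ℝ[X]) + 2) * C ((2 * (n : ℝ) + 3) / ((n : ℝ) + 2)) = 2 * (n : ℝ[X]) + 3 := by
    have : ((n : ℝ[X]) + 2) = C ((n : ℝ) + 2) := by simp [map_ofNat C]
    rw [this, ← C_mul, mul_div_cancel₀ _ hn]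
    simp [map_ofNat C]
  have h2 : ((n : ℝ[X]) + 2) * C (((n : ℝ) + 1) / ((n : ℝ) + 2)) = (n : ℝ[X]) + 1 := by
    have : ((n : ℝ[X]) + 2) = C ((n : ℝ) + 2) := by simp [map_ofNat C]
    rw [this, ← C_mul, mul_div_cancel₀ _ hn]
    simp
  rw [legendre, mul_sub, ← h1, ← h2]
  ring

theorem legendre_zero : legendre 0 = 1 := by simp [legendre]

theorem legendre_one : legendre 1 = X := by simp [legendre]

theorem derivative_legendre_relations (n : ℕ) :
    derivative (legendre (n + 1)) =
        X * derivative (legendre n) + ((n : ℝ[X]) + 1) * legendre n ∧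
      X * derivative (legendre (n + 1)) - derivative (legendre n) =
        ((n : ℝ[X]) + 1) * legendre (n + 1) := by
  induction n with
  | zero => simp [legendre_zero, legendre_one]
  | succ n ih =>
    obtain ⟨hA, hB⟩ := ih
    have hR := legendre_bonnet n
    have hD := congrArg derivative hR
    simp only [derivative_mul, derivative_sub, derivative_add, derivative_natCast,
      derivative_ofNat, derivative_X, derivative_one, mul_zero, zero_mul, zero_add,
      add_zero, mul_one] at hD
    have hn : ((n : ℝ[X]) + 2) ≠ 0 := by exact_mod_cast (Nat.succ_ne_zero (n + 1))
    have hA' : derivative (legendre (n + 1 + 1)) =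
        X * derivative (legendre (n + 1)) + ((n : ℝ[X]) + 1 + 1) * legendre (n + 1) := by
      apply mul_left_cancel₀ hn
      linear_combination hD + ((n : ℝ[X]) + 1) * hB
    push_cast
    refine ⟨hA', ?_⟩
    linear_combination X * hA' + X * hB - hA - hR

theorem derivative_legendre_succ (n : ℕ) : derivative (legendre (n + 1)) =
    X * derivative (legendre n) + ((n : ℝ[X]) + 1) * legendre n :=
  (derivative_legendre_relations n).1

theorem one_sub_sq_mul_derivative_legendre_succ (n : ℕ) :
    (1 - X ^ 2) * derivative (legendre (n + 1)) =
      ((n : ℝ[X]) + 1) * (legendre n - X * legendre (n + 1)) := by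
  obtain ⟨hA, hB⟩ := derivative_legendre_relations n
  linear_combination hA - X * hB

theorem derivative_legendre_add_two_sub (n : ℕ) :
    derivative (legendre (n + 2) - legendre n) = (2 * (n : ℝ[X]) + 3) * legendre (n + 1) := by
  obtain ⟨-, hB⟩ := derivative_legendre_relations n
  have hA := derivative_legendre_succ (n + 1)
  push_cast at hA
  rw [derivative_sub]
  linear_combination hA + hB

/-- The Legendre differential equation. -/
theorem legendre_ode (n : ℕ) : derivative ((1 - X ^ 2) * derivative (legendre n)) =
    -((n : ℝ[X]) * ((n : ℝ[X]) + 1)) * legendre n := by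
  cases n with
  | zero => simp [legendre_zero]
  | succ n =>
    rw [one_sub_sq_mul_derivative_legendre_succ]
    obtain ⟨-, hB⟩ := derivative_legendre_relations n
    simp only [derivative_mul, derivative_sub, derivative_add, derivative_natCast,
      derivative_X, derivative_one, zero_mul, zero_add, add_zero, one_mul]
    push_cast
    linear_combination -((n : ℝ[X]) + 1) * hB

theorem legendre_sub_legendre_add_two (n : ℕ) :
    ((n : ℝ[X]) + 1) * ((n : ℝ[X]) + 2) * (legendre n - legendre (n + 2)) =
      (2 * (n : ℝ[X]) + 3) * ((1 - X ^ 2) * derivative (legendre (n + 1))) := by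
  rw [one_sub_sq_mul_derivative_legendre_succ]
  linear_combination -((n : ℝ[X]) + 1) * legendre_bonnet n

theorem legendre_eval_one (n : ℕ) : (legendre n).eval 1 = 1 := by
  induction n using Nat.twoStepInduction with
  | zero => simp [legendre_zero]
  | one => simp [legendre_one]
  | more n h0 h1 =>
    have hn : (n : ℝ) + 2 ≠ 0 := by positivity
    have h := congrArg (eval 1) (legendre_bonnet n)
    simp [h0, h1] at h
    apply mul_left_cancel₀ hn
    linear_combination h

theorem legendre_eval_neg_one (n : ℕ) : (legendre n).eval (-1) = (-1) ^ n := by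
  induction n using Nat.twoStepInduction with
  | zero => simp [legendre_zero]
  | one => simp [legendre_one]
  | more n h0 h1 =>
    have hn : (n : ℝ) + 2 ≠ 0 := by positivity
    have h := congrArg (eval (-1)) (legendre_bonnet n)
    simp [h0, h1] at h
    apply mul_left_cancel₀ hn
    linear_combination h

theorem legendre_eval_zero_sq_le (n : ℕ) : ((n : ℝ) + 1) * (legendre n).eval 0 ^ 2 ≤ 1 := by
  induction n using Nat.twoStepInduction with
  | zero => simp [legendre_zero]
  | one => simp [legendre_one]
  | more n h0 _ =>
    have hn : (0 : ℝ) < (n : ℝ) + 2 := by positivity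
    have h := congrArg (eval 0) (legendre_bonnet n)
    simp at h
    have h' : (legendre (n + 2)).eval 0 =
        -(((n : ℝ) + 1) * (legendre n).eval 0) / ((n : ℝ) + 2) := by
      rw [eq_div_iff hn.ne']
      linear_combination h
    rw [h', div_pow, ← mul_div_assoc, div_le_one (by positivity)]
    push_cast
    have h3 : ((n : ℝ) + 3) * ((n : ℝ) + 1) * (((n : ℝ) + 1) * (legendre n).eval 0 ^ 2) ≤
        ((n : ℝ) + 3) * ((n : ℝ) + 1) * 1 := by gcongr
    linarith

/-- A polynomial whose derivative is nonpositive to the right and nonnegative to the left of `0`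
is maximal at `0`. -/
theorem eval_le_eval_zero {q : ℝ[X]} (h : ∀ y, y * (derivative q).eval y ≤ 0) (x : ℝ) :
    q.eval x ≤ q.eval 0 := by
  rcases le_total 0 x with hx | hx
  · refine antitoneOn_of_deriv_nonpos (convex_Ici (0 : ℝ)) q.continuousOn
      q.differentiable.differentiableOn (fun y hy => ?_) Set.self_mem_Ici hx hx
    rw [interior_Ici] at hy
    rw [q.deriv]
    exact nonpos_of_mul_nonpos_right (h y) hy
  · refine monotoneOn_of_deriv_nonneg (convex_Iic (0 : ℝ)) q.continuousOn
      q.differentiable.differentiableOn (fun y hy => ?_) hx Set.self_mem_Iic hx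
    rw [interior_Iic] at hy
    rw [q.deriv]
    have := h y
    by_contra! hneg
    exact absurd (mul_pos_of_neg_of_neg hy hneg) this.not_gt

theorem one_sub_sq_mul_derivative_legendre_sq_le (n : ℕ) {x : ℝ} (hx : x ^ 2 ≤ 1) :
    ((1 - x ^ 2) * (derivative (legendre (n + 1))).eval x) ^ 2 ≤ 2 * ((n : ℝ) + 1) := by
  set P := legendre (n + 1) with hP
  set u := (1 - X ^ 2) * derivative P with hu
  set l : ℝ[X] := ((n : ℝ[X]) + 1) * ((n : ℝ[X]) + 2) with hl
  have hode : derivative u = -l * P := by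
    have := legendre_ode (n + 1)
    push_cast at this
    rw [hu, hP, this, hl]
    ring
  have hdl : derivative l = 0 := by simp [hl]
  have hle : ∀ y, l.eval y = ((n : ℝ) + 1) * ((n : ℝ) + 2) := by simp [hl]
  have hS : derivative (u ^ 2 + l * (1 - X ^ 2) * P ^ 2) = -2 * l * X * P ^ 2 := by
    simp only [derivative_add, derivative_mul, derivative_pow, derivative_sub, derivative_one,
      derivative_X, hode, hdl]
    simp only [map_natCast, hu]
    push_cast
    ring
  have key := eval_le_eval_zero (q := u ^ 2 + l * (1 - X ^ 2) * P ^ 2) (fun y => by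
    have : 0 ≤ ((n : ℝ) + 1) * ((n : ℝ) + 2) * (y * P.eval y) ^ 2 := by positivity
    rw [hS]
    simp only [eval_mul, eval_pow, eval_X, hle, eval_neg, eval_ofNat]
    linarith) x
  have hP0 : (derivative P).eval 0 = ((n : ℝ) + 1) * (legendre n).eval 0 := by
    simp [hP, derivative_legendre_succ]
  have h0 := legendre_eval_zero_sq_le n
  have h1 := legendre_eval_zero_sq_le (n + 1)
  simp only [eval_add, eval_mul, eval_pow, eval_X, hle, eval_sub, eval_one, hu, hP0] at key
  have h2 : 0 ≤ ((n : ℝ) + 1) * ((n : ℝ) + 2) * (1 - x ^ 2) * P.eval x ^ 2 := by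
    have : 0 ≤ 1 - x ^ 2 := by linarith
    positivity
  push_cast at h1
  have h3 := mul_le_mul_of_nonneg_left h0 (by positivity : (0 : ℝ) ≤ (n : ℝ) + 1)
  have h4 := mul_le_mul_of_nonneg_left h1 (by positivity : (0 : ℝ) ≤ (n : ℝ) + 1)
  rw [← hP] at h4
  linarith

theorem legendre_sub_legendre_add_two_sq_le (n : ℕ) {x : ℝ} (hx : x ^ 2 ≤ 1) :
    ((legendre n).eval x - (legendre (n + 2)).eval x) ^ 2 ≤ 8 / ((n : ℝ) + 1) := by
  have h := congrArg (eval x) (legendre_sub_legendre_add_two n)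
  simp only [eval_add, eval_mul, eval_pow, eval_X, eval_sub, eval_one, eval_natCast,
    eval_ofNat] at h
  have h1 := one_sub_sq_mul_derivative_legendre_sq_le n hx
  set d := (legendre n).eval x - (legendre (n + 2)).eval x
  set u := (1 - x ^ 2) * (derivative (legendre (n + 1))).eval x
  have hn : (0 : ℝ) ≤ n := Nat.cast_nonneg n
  have h2 : (((n : ℝ) + 1) * ((n : ℝ) + 2)) ^ 2 * d ^ 2 ≤
      (2 * (n : ℝ) + 3) ^ 2 * (2 * ((n : ℝ) + 1)) := by
    rw [← mul_pow, h, mul_pow]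
    gcongr
  have h3 : (2 * (n : ℝ) + 3) ^ 2 ≤ 4 * ((n : ℝ) + 2) ^ 2 := by nlinarith
  rw [le_div_iff₀ (by positivity)]
  have h4 : (2 * (n : ℝ) + 3) ^ 2 * (2 * ((n : ℝ) + 1)) ≤
      4 * ((n : ℝ) + 2) ^ 2 * (2 * ((n : ℝ) + 1)) := by gcongr
  have h5 : 0 < ((n : ℝ) + 1) * ((n : ℝ) + 2) ^ 2 := by positivity
  apply le_of_mul_le_mul_left _ h5
  linarith

theorem abs_legendre_le_one (n : ℕ) {x : ℝ} (hx : x ∈ Set.Icc (-1 : ℝ) 1) :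
    |(legendre n).eval x| ≤ 1 := by
  cases n with
  | zero => simp [legendre_zero]
  | succ n =>
  set P := legendre (n + 1) with hP
  set l : ℝ[X] := ((n : ℝ[X]) + 1) * ((n : ℝ[X]) + 2) with hl
  have hdl : derivative l = 0 := by simp [hl]
  have hle : ∀ y, l.eval y = ((n : ℝ) + 1) * ((n : ℝ) + 2) := by simp [hl]
  set S := l * P ^ 2 + (1 - X ^ 2) * derivative P ^ 2 with hSdef
  have hode : (1 - X ^ 2) * derivative (derivative P) = 2 * X * derivative P - l * P := by
    have := legendre_ode (n + 1)
    rw [derivative_mul, ← hP] at this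
    simp only [derivative_sub, derivative_pow, derivative_X, derivative_one, map_natCast] at this
    push_cast at this
    linear_combination this
  have hS : derivative S = 2 * X * derivative P ^ 2 := by
    simp only [hSdef, derivative_add, derivative_mul, derivative_pow, derivative_sub,
      derivative_one, derivative_X, hdl, map_natCast]
    push_cast
    linear_combination 2 * derivative P * hode
  have hS1 : S.eval 1 = ((n : ℝ) + 1) * ((n : ℝ) + 2) := by
    simp [hSdef, hle, hP, legendre_eval_one]
  have hSm1 : S.eval (-1) = ((n : ℝ) + 1) * ((n : ℝ) + 2) := by
    simp [hSdef, hle, hP, legendre_eval_neg_one, ← pow_mul, mul_comm _ 2]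
  have key : S.eval x ≤ ((n : ℝ) + 1) * ((n : ℝ) + 2) := by
    rcases le_total 0 x with h0 | h0
    · rw [← hS1]
      refine monotoneOn_of_deriv_nonneg (convex_Ici (0 : ℝ)) S.continuousOn
        S.differentiable.differentiableOn (fun y hy => ?_) h0 (Set.mem_Ici.2 zero_le_one) hx.2
      rw [interior_Ici] at hy
      have : (0 : ℝ) < y := hy
      simp only [S.deriv, hS, eval_mul, eval_pow, eval_X, eval_ofNat]
      positivity
    · rw [← hSm1]
      refine antitoneOn_of_deriv_nonpos (convex_Iic (0 : ℝ)) S.continuousOn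
        S.differentiable.differentiableOn (fun y hy => ?_)
        (Set.mem_Iic.2 (by norm_num)) h0 hx.1
      rw [interior_Iic] at hy
      have hy' : y < 0 := hy
      simp only [S.deriv, hS, eval_mul, eval_pow, eval_X, eval_ofNat]
      have := sq_nonneg ((derivative P).eval y)
      nlinarith
  have hx2 : 0 ≤ 1 - x ^ 2 := by nlinarith [hx.1, hx.2]
  have h1 : 0 ≤ (1 - x ^ 2) * (derivative P).eval x ^ 2 := by positivity
  simp only [hSdef, eval_add, eval_mul, eval_pow, eval_X, hle, eval_sub, eval_one] at key
  rw [← sq_le_one_iff_abs_le_one]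
  apply le_of_mul_le_mul_left _ (by positivity : 0 < ((n : ℝ) + 1) * ((n : ℝ) + 2))
  linarith

/-- Integration of polynomials over `[-1, 1]`. -/
noncomputable def polyIntegral : ℝ[X] →ₗ[ℝ] ℝ where
  toFun f := ∫ y in (-1 : ℝ)..1, f.eval y
  map_add' f g := by
    simp only [eval_add]
    exact integral_add (f.continuous.intervalIntegrable _ _) (g.continuous.intervalIntegrable _ _)
  map_smul' c f := by
    simp only [eval_smul, smul_eq_mul, RingHom.id_apply]
    exact integral_const_mul c _

theorem polyIntegral_apply (f : ℝ[X]) : polyIntegral f = ∫ y in (-1 : ℝ)..1, f.eval y := rfl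

theorem polyIntegral_C_mul (c : ℝ) (f : ℝ[X]) :
    polyIntegral (C c * f) = c * polyIntegral f := by
  rw [← smul_eq_C_mul, map_smul, smul_eq_mul]

theorem polyIntegral_derivative (f : ℝ[X]) :
    polyIntegral (derivative f) = f.eval 1 - f.eval (-1) :=
  integral_eq_sub_of_hasDerivAt (fun y _ => f.hasDerivAt y)
    ((derivative f).continuous.intervalIntegrable _ _)

theorem polyIntegral_legendre_mul_of_ne {j k : ℕ} (h : j ≠ k) :
    polyIntegral (legendre j * legendre k) = 0 := by
  have hW : derivative ((1 - X ^ 2) * derivative (legendre k) * legendre j -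
      (1 - X ^ 2) * derivative (legendre j) * legendre k) =
      C ((j : ℝ) * (j + 1) - k * (k + 1)) * (legendre j * legendre k) := by
    rw [derivative_sub, derivative_mul (g := legendre j), derivative_mul (g := legendre k),
      legendre_ode, legendre_ode]
    simp only [C_sub, C_mul, C_add, C_1, map_natCast]
    ring
  have h1 := polyIntegral_derivative ((1 - X ^ 2) * derivative (legendre k) * legendre j -
      (1 - X ^ 2) * derivative (legendre j) * legendre k)
  rw [hW, polyIntegral_C_mul] at h1
  simp only [eval_sub, eval_mul, eval_one, eval_pow, eval_X] at h1
  norm_num at h1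
  refine h1.resolve_left fun h0 => h ?_
  have : ((j : ℝ) - k) * (j + k + 1) = 0 := by linear_combination h0
  have hpos : (j : ℝ) + k + 1 ≠ 0 := by positivity
  have := (mul_eq_zero.1 this).resolve_right hpos
  exact_mod_cast sub_eq_zero.1 this

theorem polyIntegral_legendre_sq (n : ℕ) :
    (2 * (n : ℝ) + 1) * polyIntegral (legendre n * legendre n) = 2 := by
  induction n using Nat.twoStepInduction with
  | zero =>
    simp [legendre_zero, polyIntegral_apply]
    norm_num
  | one =>
    have : ∫ y in (-1 : ℝ)..1, y * y = 2 / 3 := by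
      simp only [← sq]
      rw [integral_pow]
      norm_num
    simp [legendre_one, polyIntegral_apply, this]
    norm_num
  | more n _ ih =>
    have hn : (n : ℝ) + 2 ≠ 0 := by positivity
    have e1 : C ((n : ℝ) + 2) * (legendre (n + 2) * legendre (n + 2)) =
        C (2 * (n : ℝ) + 3) * (X * legendre (n + 1) * legendre (n + 2)) -
          C ((n : ℝ) + 1) * (legendre n * legendre (n + 2)) := by
      simp only [C_mul, C_add, C_1, map_natCast, map_ofNat C]
      linear_combination legendre (n + 2) * legendre_bonnet n
    have e2 : C ((n : ℝ) + 3) * (legendre (n + 1) * legendre (n + 3)) =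
        C (2 * (n : ℝ) + 5) * (X * legendre (n + 1) * legendre (n + 2)) -
          C ((n : ℝ) + 2) * (legendre (n + 1) * legendre (n + 1)) := by
      have := legendre_bonnet (n + 1)
      push_cast at this
      simp only [C_mul, C_add, map_natCast, map_ofNat C]
      linear_combination legendre (n + 1) * this
    replace e1 := congrArg polyIntegral e1
    replace e2 := congrArg polyIntegral e2
    simp only [map_sub, polyIntegral_C_mul] at e1 e2
    rw [polyIntegral_legendre_mul_of_ne (by omega : n ≠ n + 2)] at e1
    rw [polyIntegral_legendre_mul_of_ne (by omega : n + 1 ≠ n + 3)] at e2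
    apply mul_left_cancel₀ hn
    push_cast at ih ⊢
    linear_combination (2 * (n : ℝ) + 5) * e1 - (2 * (n : ℝ) + 3) * e2 + ((n : ℝ) + 2) * ih

theorem span_range_legendre : Submodule.span ℝ (Set.range legendre) = ⊤ := by
  have hX : ∀ f ∈ Submodule.span ℝ (Set.range legendre),
      X * f ∈ Submodule.span ℝ (Set.range legendre) := by
    intro f hf
    induction hf using Submodule.span_induction with
    | zero => simp
    | add f g _ _ hf hg => rw [mul_add]; exact add_mem hf hg
    | smul c f _ hf => rw [mul_smul_comm]; exact Submodule.smul_mem _ _ hf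
    | mem f hf =>
      obtain ⟨n, rfl⟩ := hf
      cases n with
      | zero =>
        rw [legendre_zero, mul_one, ← legendre_one]
        exact Submodule.subset_span ⟨1, rfl⟩
      | succ n =>
        have hn : 2 * (n : ℝ) + 3 ≠ 0 := by positivity
        have : X * legendre (n + 1) = (2 * (n : ℝ) + 3)⁻¹ •
            (((n : ℝ) + 2) • legendre (n + 2) + ((n : ℝ) + 1) • legendre n) := by
          rw [eq_inv_smul_iff₀ hn]
          simp only [smul_eq_C_mul, C_mul, C_add, C_1, map_natCast, map_ofNat C]
          linear_combination -legendre_bonnet n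
        rw [this]
        exact Submodule.smul_mem _ _ (add_mem
          (Submodule.smul_mem _ _ (Submodule.subset_span ⟨_, rfl⟩))
          (Submodule.smul_mem _ _ (Submodule.subset_span ⟨_, rfl⟩)))
  have hpow : ∀ n : ℕ, (X : ℝ[X]) ^ n ∈ Submodule.span ℝ (Set.range legendre) := by
    intro n
    induction n with
    | zero => rw [pow_zero, ← legendre_zero]; exact Submodule.subset_span ⟨0, rfl⟩
    | succ n ih => rw [pow_succ']; exact hX _ ih
  refine eq_top_iff.2 fun f _ => ?_
  induction f using Polynomial.induction_on' with
  | add f g hf hg => exact add_mem (hf trivial) (hg trivial)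
  | monomial n a =>
    rw [← C_mul_X_pow_eq_monomial, ← smul_eq_C_mul]
    exact Submodule.smul_mem _ _ (hpow n)

/-- Every polynomial equals its Fourier–Legendre series, which is a finite sum. -/
theorem exists_forall_eq_sum_legendre (f : ℝ[X]) : ∃ D, ∀ L ≥ D,
    f = ∑ k ∈ Finset.range L,
      C ((2 * (k : ℝ) + 1) / 2 * polyIntegral (f * legendre k)) * legendre k := by
  have hf : f ∈ Submodule.span ℝ (Set.range legendre) := by
    rw [span_range_legendre]; trivial
  induction hf using Submodule.span_induction with
  | zero => exact ⟨0, by simp⟩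
  | add f g _ _ hf hg =>
    obtain ⟨D, hD⟩ := hf
    obtain ⟨E, hE⟩ := hg
    refine ⟨max D E, fun L hL => ?_⟩
    conv_lhs => rw [hD L (le_trans (le_max_left _ _) hL), hE L (le_trans (le_max_right _ _) hL)]
    simp only [add_mul, map_add, mul_add, Finset.sum_add_distrib]
  | smul c f _ hf =>
    obtain ⟨D, hD⟩ := hf
    refine ⟨D, fun L hL => ?_⟩
    conv_lhs => rw [hD L hL]
    rw [Finset.smul_sum]
    refine Finset.sum_congr rfl fun k _ => ?_
    rw [smul_mul_assoc, map_smul, smul_eq_mul, smul_eq_C_mul]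
    simp only [C_mul]
    ring
  | mem f hf =>
    obtain ⟨n, rfl⟩ := hf
    refine ⟨n + 1, fun L hL => ?_⟩
    rw [Finset.sum_eq_single n]
    · have h : (2 * (n : ℝ) + 1) / 2 * polyIntegral (legendre n * legendre n) = 1 := by
        linear_combination polyIntegral_legendre_sq n / 2
      rw [h, C_1, one_mul]
    · intro k _ hk
      rw [polyIntegral_legendre_mul_of_ne hk.symm, mul_zero, C_0, zero_mul]
    · intro h
      exact absurd (Finset.mem_range.2 hL) h

/-- The Fourier–Legendre coefficients of `h`, in terms of those of its derivative. -/
theorem polyIntegral_mul_legendre_succ (h : ℝ[X]) (n : ℕ) :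
    (2 * (n : ℝ) + 3) * polyIntegral (h * legendre (n + 1)) =
      polyIntegral (derivative h * legendre n) - polyIntegral (derivative h * legendre (n + 2)) := by
  have h0 := polyIntegral_derivative (h * (legendre (n + 2) - legendre n))
  have e : derivative (h * (legendre (n + 2) - legendre n)) =
      derivative h * legendre (n + 2) - derivative h * legendre n +
        C (2 * (n : ℝ) + 3) * (h * legendre (n + 1)) := by
    rw [derivative_mul, derivative_legendre_add_two_sub]
    simp only [C_mul, C_add, map_natCast, map_ofNat C]
    ring
  rw [e, map_add, map_sub, polyIntegral_C_mul] at h0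
  simp only [eval_mul, eval_sub, legendre_eval_one, legendre_eval_neg_one] at h0
  linear_combination h0

/-- The contribution of `legendre k` to the squared `L²` norm of `f`. -/
noncomputable def legendreEnergy (f : ℝ[X]) (k : ℕ) : ℝ :=
  (2 * (k : ℝ) + 1) / 2 * polyIntegral (f * legendre k) ^ 2

theorem legendreEnergy_nonneg (f : ℝ[X]) (k : ℕ) : 0 ≤ legendreEnergy f k := by
  unfold legendreEnergy; positivity

theorem sum_legendreEnergy_le (f : ℝ[X]) (N m : ℕ) :
    ∑ i ∈ Finset.range m, legendreEnergy f (N + i) ≤ polyIntegral (f * f) := by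
  obtain ⟨D, hD⟩ := exists_forall_eq_sum_legendre f
  have hf := hD (max D (N + m)) (le_max_left _ _)
  set L := max D (N + m) with hL
  have h1 : polyIntegral (f * f) = ∑ k ∈ Finset.range L, legendreEnergy f k := by
    conv_lhs => rw [hf, Finset.sum_mul, map_sum]
    refine Finset.sum_congr rfl fun k _ => ?_
    rw [← hf, mul_assoc, polyIntegral_C_mul, legendreEnergy, mul_comm (legendre k)]
    ring
  calc ∑ i ∈ Finset.range m, legendreEnergy f (N + i)
      ≤ ∑ k ∈ Finset.range (N + m), legendreEnergy f k := by
        rw [Finset.sum_range_add]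
        exact le_add_of_nonneg_left (Finset.sum_nonneg fun i _ => legendreEnergy_nonneg _ _)
    _ ≤ ∑ k ∈ Finset.range L, legendreEnergy f k :=
        Finset.sum_le_sum_of_subset_of_nonneg
          (Finset.range_subset_range.2 (le_max_right _ _))
          fun i _ _ => legendreEnergy_nonneg _ _
    _ = polyIntegral (f * f) := h1.symm

theorem sum_legendreEnergy_succ_le {h : ℝ[X]} {N : ℕ} (hN : 0 < N) {B : ℝ}
    (hB : ∀ m, ∑ i ∈ Finset.range m, legendreEnergy (derivative h) (N + i) ≤ B) (m : ℕ) :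
    ∑ i ∈ Finset.range m, legendreEnergy h (N + 1 + i) ≤ B / (N : ℝ) ^ 2 := by
  have hN' : (0 : ℝ) < N := by exact_mod_cast hN
  have key : ∀ i, legendreEnergy h (N + 1 + i) ≤ (legendreEnergy (derivative h) (N + i) +
      legendreEnergy (derivative h) (N + (i + 2))) / (2 * (N : ℝ) ^ 2) := by
    intro i
    have hr := polyIntegral_mul_legendre_succ h (N + i)
    rw [show N + i + 1 = N + 1 + i by ring, show N + i + 2 = N + (i + 2) by ring] at hr
    unfold legendreEnergy
    set a := polyIntegral (derivative h * legendre (N + i))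
    set b := polyIntegral (derivative h * legendre (N + (i + 2)))
    set c := polyIntegral (h * legendre (N + 1 + i))
    push_cast at hr ⊢
    have hi : (0 : ℝ) ≤ i := Nat.cast_nonneg i
    rw [le_div_iff₀ (by positivity)]
    have hs : (2 * ((N : ℝ) + i) + 3) ^ 2 * c ^ 2 ≤ 2 * (a ^ 2 + b ^ 2) := by
      rw [← mul_pow, hr]
      nlinarith [sq_nonneg (a + b)]
    have h3 : (0 : ℝ) < 2 * ((N : ℝ) + i) + 3 := by positivity
    have h4 : 2 * (N : ℝ) ^ 2 * (a ^ 2 + b ^ 2) ≤ (2 * ((N : ℝ) + i) + 3) *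
        ((2 * ((N : ℝ) + i) + 1) / 2 * a ^ 2 + (2 * ((N : ℝ) + (i + 2)) + 1) / 2 * b ^ 2) := by
      have ha : 4 * (N : ℝ) ^ 2 ≤ (2 * ((N : ℝ) + i) + 3) * (2 * ((N : ℝ) + i) + 1) := by
        nlinarith
      have hb : 4 * (N : ℝ) ^ 2 ≤ (2 * ((N : ℝ) + i) + 3) * (2 * ((N : ℝ) + (i + 2)) + 1) := by
        nlinarith
      have := mul_le_mul_of_nonneg_right ha (sq_nonneg a)
      have := mul_le_mul_of_nonneg_right hb (sq_nonneg b)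
      linarith
    have h5 := mul_le_mul_of_nonneg_left hs (sq_nonneg (N : ℝ))
    apply le_of_mul_le_mul_left _ h3
    linarith
  calc ∑ i ∈ Finset.range m, legendreEnergy h (N + 1 + i)
      ≤ ∑ i ∈ Finset.range m, (legendreEnergy (derivative h) (N + i) +
          legendreEnergy (derivative h) (N + (i + 2))) / (2 * (N : ℝ) ^ 2) :=
        Finset.sum_le_sum fun i _ => key i
    _ = (∑ i ∈ Finset.range m, legendreEnergy (derivative h) (N + i) +
          ∑ i ∈ Finset.range m, legendreEnergy (derivative h) (N + 2 + i)) / (2 * (N : ℝ) ^ 2) := by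
        rw [← Finset.sum_div, Finset.sum_add_distrib]
        simp only [add_assoc, add_comm 2]
    _ ≤ (B + B) / (2 * (N : ℝ) ^ 2) := by
        gcongr
        · exact hB m
        · refine le_trans ?_ (hB (m + 2))
          rw [add_comm m 2, Finset.sum_range_add]
          simp only [← add_assoc]
          exact le_add_of_nonneg_left (Finset.sum_nonneg fun i _ => legendreEnergy_nonneg _ _)
    _ = B / (N : ℝ) ^ 2 := by field_simp; ring

theorem exists_forall_polyIntegral_mul_legendre_eq_zero (f : ℝ[X]) :
    ∃ D, ∀ k ≥ D, polyIntegral (f * legendre k) = 0 := by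
  obtain ⟨D, hD⟩ := exists_forall_eq_sum_legendre f
  refine ⟨D, fun k hk => ?_⟩
  have h := hD (k + 1) (by omega)
  rw [Finset.sum_range_succ, ← hD k hk, left_eq_add] at h
  replace h := congrArg (eval 1) h
  simp only [eval_mul, eval_C, legendre_eval_one, eval_zero, mul_one] at h
  exact (mul_eq_zero.1 h).resolve_left (by positivity)

theorem sum_sub_mul_eq_sum_mul_sub (b P : ℕ → ℝ) (N m : ℕ) :
    ∑ i ∈ Finset.range m, (b (N + i) - b (N + i + 2)) * P (N + i + 1) =
      ∑ i ∈ Finset.range m, b (N + i + 1) * (P (N + i + 2) - P (N + i)) +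
        b N * P (N + 1) + b (N + 1) * P N - b (N + m) * P (N + m + 1) -
        b (N + m + 1) * P (N + m) := by
  induction m with
  | zero => simp
  | succ m ih =>
    rw [Finset.sum_range_succ, Finset.sum_range_succ, ih]
    simp only [← add_assoc]
    ring

theorem sum_two_div_sq_le {N : ℕ} (hN : 0 < N) (m : ℕ) :
    ∑ i ∈ Finset.range m, 2 / ((N : ℝ) + i + 1) ^ 2 ≤ 2 / N - 2 / ((N : ℝ) + m) := by
  have hN' : (0 : ℝ) < N := by exact_mod_cast hN
  induction m with
  | zero => simp
  | succ m ih =>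
    rw [Finset.sum_range_succ]
    have : 2 / ((N : ℝ) + m + 1) ^ 2 ≤ 2 / ((N : ℝ) + m) - 2 / ((N : ℝ) + m + 1) := by
      rw [div_sub_div _ _ (by positivity) (by positivity),
        div_le_div_iff₀ (by positivity) (by positivity)]
      have : (0 : ℝ) < N + m := by positivity
      nlinarith
    push_cast
    rw [← add_assoc]
    linarith

theorem sq_eval_sub_partialSum_le {G : ℝ[X]} {N : ℕ} (hN : 0 < N) {B : ℝ}
    (hB : ∀ m, ∑ i ∈ Finset.range m, legendreEnergy (derivative G) (N + i) ≤ B)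
    {x : ℝ} (hx : x ∈ Set.Icc (-1 : ℝ) 1) :
    (G.eval x - ∑ k ∈ Finset.range (N + 1),
      ((2 * (k : ℝ) + 1) / 2 * polyIntegral (G * legendre k)) * (legendre k).eval x) ^ 2 ≤
      8 * B / N := by
  have hN' : (0 : ℝ) < N := by exact_mod_cast hN
  have hx2 : x ^ 2 ≤ 1 := by nlinarith [hx.1, hx.2]
  obtain ⟨D, hD⟩ := exists_forall_eq_sum_legendre G
  obtain ⟨E, hE⟩ := exists_forall_polyIntegral_mul_legendre_eq_zero (derivative G)
  set J : ℕ → ℝ := fun k => polyIntegral (derivative G * legendre k) / 2 with hJ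
  set P : ℕ → ℝ := fun k => (legendre k).eval x with hP
  set m := max D E with hm
  have hG : G.eval x = ∑ k ∈ Finset.range (N + 1 + m),
      ((2 * (k : ℝ) + 1) / 2 * polyIntegral (G * legendre k)) * P k := by
    conv_lhs => rw [hD (N + 1 + m) (by omega)]
    simp [eval_finsetSum, hP]
  have hJ0 : ∀ k ≥ m, J k = 0 := fun k hk => by
    simp only [hJ, hE k (by omega), zero_div]
  have herr : G.eval x - ∑ k ∈ Finset.range (N + 1),
      ((2 * (k : ℝ) + 1) / 2 * polyIntegral (G * legendre k)) * P k =
      ∑ i ∈ Finset.range m, J (N + i + 1) * (P (N + i + 2) - P (N + i)) +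
        J N * P (N + 1) + J (N + 1) * P N := by
    have h1 := sum_sub_mul_eq_sum_mul_sub J P N m
    rw [hJ0 (N + m) (by omega), hJ0 (N + m + 1) (by omega), zero_mul, zero_mul, sub_zero,
      sub_zero] at h1
    rw [hG, Finset.sum_range_add, add_sub_cancel_left, ← h1]
    refine Finset.sum_congr rfl fun i _ => ?_
    have h2 := polyIntegral_mul_legendre_succ G (N + i)
    rw [show N + 1 + i = N + i + 1 by ring]
    simp only [hJ]
    push_cast at h2 ⊢
    linear_combination P (N + i + 1) * h2 / 2
  rw [herr]
  have hJsq : ∀ k, J k ^ 2 = legendreEnergy (derivative G) k / (2 * (2 * (k : ℝ) + 1)) := by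
    intro k
    simp only [hJ, legendreEnergy]
    field_simp
  have hB0 : 0 ≤ B := by simpa using hB 0
  have hsingle : ∀ i, legendreEnergy (derivative G) (N + i) ≤ B := fun i =>
    (Finset.single_le_sum (f := fun i => legendreEnergy (derivative G) (N + i))
      (fun i _ => legendreEnergy_nonneg _ _) (Finset.self_mem_range_succ i)).trans (hB (i + 1))
  have hJle : ∀ i, J (N + i) ^ 2 ≤ B / (4 * N) := by
    intro i
    rw [hJsq]
    have : (4 * N : ℝ) ≤ 2 * (2 * ((N + i : ℕ) : ℝ) + 1) := by
      push_cast
      have : (0 : ℝ) ≤ i := Nat.cast_nonneg i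
      linarith
    exact div_le_div₀ hB0 (hsingle i) (by positivity) this
  have hPle : ∀ k, P k ^ 2 ≤ 1 := fun k =>
    (sq_le_one_iff_abs_le_one _).2 (abs_legendre_le_one k hx)
  have hterm : ∀ i j, (J (N + i) * P j) ^ 2 ≤ B / (4 * N) := by
    intro i j
    rw [mul_pow]
    exact (mul_le_of_le_one_right (sq_nonneg _) (hPle j)).trans (hJle i)
  have hmain : (∑ i ∈ Finset.range m, J (N + i + 1) * (P (N + i + 2) - P (N + i))) ^ 2 ≤
      B * (2 / N) := by
    have hcs := Finset.sum_sq_le_sum_mul_sum_of_sq_le_mul (Finset.range m)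
      (r := fun i => J (N + i + 1) * (P (N + i + 2) - P (N + i)))
      (f := fun i => legendreEnergy (derivative G) (N + (i + 1)))
      (g := fun i => (P (N + i) - P (N + i + 2)) ^ 2 / (2 * (2 * ((N : ℝ) + i + 1) + 1)))
      (fun i _ => legendreEnergy_nonneg _ _) (fun i _ => by positivity)
      (fun i _ => by
        rw [mul_pow, hJsq]
        push_cast
        rw [← add_assoc]
        exact le_of_eq (by ring))
    refine hcs.trans (mul_le_mul ?_ ?_ (Finset.sum_nonneg fun i _ => by positivity) hB0)
    · refine le_trans ?_ (hB (m + 1))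
      rw [Finset.sum_range_succ']
      exact le_add_of_nonneg_right (legendreEnergy_nonneg _ _)
    · refine le_trans (Finset.sum_le_sum fun i _ => ?_) ((sum_two_div_sq_le hN m).trans
        (sub_le_self _ (by positivity)))
      have h8 := legendre_sub_legendre_add_two_sq_le (N + i) hx2
      push_cast at h8
      have hd : (0 : ℝ) < (N : ℝ) + i + 1 := by positivity
      rw [div_le_div_iff₀ (by positivity) (by positivity)]
      rw [le_div_iff₀ hd] at h8
      simp only [hP]
      nlinarith
  have h1 := hterm 0 (N + 1)
  have h2 := hterm 1 N
  rw [add_zero] at h1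
  have hq : B / (4 * N) = B / N / 4 := by field_simp
  have hq2 : B * (2 / N) = 2 * (B / N) := by ring
  rw [hq] at h1 h2
  rw [hq2] at hmain
  have hBN : 0 ≤ B / N := by positivity
  rw [mul_div_assoc]
  generalize ∑ i ∈ Finset.range m, J (N + i + 1) * (P (N + i + 2) - P (N + i)) = s at *
  generalize J N * P (N + 1) = t at *
  generalize J (N + 1) * P N = u at *
  nlinarith [sq_nonneg (s - t), sq_nonneg (t - u), sq_nonneg (s - u)]

theorem sum_legendreEnergy_le_iterate_derivative {K : ℕ} (hK : 0 < K) (p : ℕ) (h : ℝ[X]) (m : ℕ) :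
    ∑ i ∈ Finset.range m, legendreEnergy h (K + p + i) ≤
      polyIntegral (derivative^[p] h * derivative^[p] h) / (K : ℝ) ^ (2 * p) := by
  have hK' : (0 : ℝ) < K := by exact_mod_cast hK
  induction p generalizing h m with
  | zero => simpa using sum_legendreEnergy_le h K m
  | succ p ih =>
    refine (sum_legendreEnergy_succ_le (by omega) (ih (derivative h)) m).trans ?_
    rw [← Function.iterate_succ_apply, div_div]
    have h0 : 0 ≤ polyIntegral (derivative^[p + 1] h * derivative^[p + 1] h) :=
      (Finset.sum_nonneg fun i _ => legendreEnergy_nonneg _ _).trans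
        (sum_legendreEnergy_le (derivative^[p + 1] h) 0 0)
    refine div_le_div_of_nonneg_left h0 (by positivity) ?_
    rw [mul_add, mul_one, pow_add]
    gcongr
    omega

theorem polyIntegral_mul_self_le {f : ℝ[X]} {M : ℝ}
    (hM : ∀ y ∈ Set.Icc (-1 : ℝ) 1, |f.eval y| ≤ M) : polyIntegral (f * f) ≤ 2 * M ^ 2 := by
  have h := integral_mono_on (μ := volume) (a := (-1 : ℝ)) (b := 1) (f := fun y => (f * f).eval y)
    (g := fun _ => M ^ 2) (by norm_num) ((f * f).continuous.intervalIntegrable _ _)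
    (by simp) (fun y hy => by
      rw [eval_mul, ← sq]
      exact sq_le_sq' (abs_le.1 (hM y hy)).1 (abs_le.1 (hM y hy)).2)
  refine h.trans_eq ?_
  simp
  norm_num

theorem abs_eval_sub_partialSum_le {p N : ℕ} (hpN : p + 1 < N) {G : ℝ[X]} {M : ℝ}
    (hM : ∀ y ∈ Set.Icc (-1 : ℝ) 1, |(derivative^[p + 1] G).eval y| ≤ M)
    {x : ℝ} (hx : x ∈ Set.Icc (-1 : ℝ) 1) :
    |G.eval x - ∑ k ∈ Finset.range (N + 1),
      ((2 * (k : ℝ) + 1) / 2 * polyIntegral (G * legendre k)) * (legendre k).eval x| ≤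
      4 * ((p : ℝ) + 1) ^ p * M / (N : ℝ) ^ ((p : ℝ) + 1 / 2) := by
  have hN' : (0 : ℝ) < N := by exact_mod_cast (by omega : 0 < N)
  have hM0 : 0 ≤ M := (abs_nonneg _).trans (hM x hx)
  obtain ⟨K, hK, rfl⟩ : ∃ K, 0 < K ∧ N = K + p := ⟨N - p, by omega, by omega⟩
  have hK' : (0 : ℝ) < K := by exact_mod_cast hK
  have h1 := sq_eval_sub_partialSum_le (by omega)
    (sum_legendreEnergy_le_iterate_derivative hK p (derivative G)) hx
  rw [← Function.iterate_succ_apply] at h1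
  have h2 := polyIntegral_mul_self_le hM
  set N := K + p with hN
  have hKN : (N : ℝ) ≤ ((p : ℝ) + 1) * K := by
    have : (1 : ℝ) ≤ K := by exact_mod_cast hK
    have : (0 : ℝ) ≤ p := Nat.cast_nonneg p
    rw [hN]; push_cast
    nlinarith
  have hrp : ((N : ℝ) ^ ((p : ℝ) + 1 / 2)) ^ 2 = (N : ℝ) ^ (2 * p) * N := by
    rw [← Real.rpow_natCast, ← Real.rpow_mul hN'.le, ← pow_succ, ← Real.rpow_natCast]
    congr 1
    push_cast
    ring
  apply abs_le_of_sq_le_sq _ (by positivity)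
  rw [div_pow, hrp]
  refine h1.trans ?_
  rw [div_le_div_iff₀ hN' (by positivity)]
  have h3 : (N : ℝ) ^ (2 * p) ≤ ((p : ℝ) + 1) ^ (2 * p) * (K : ℝ) ^ (2 * p) := by
    rw [← mul_pow]; gcongr
  calc 8 * (polyIntegral (derivative^[p + 1] G * derivative^[p + 1] G) / (K : ℝ) ^ (2 * p)) *
        ((N : ℝ) ^ (2 * p) * N)
      ≤ 8 * (2 * M ^ 2 / (K : ℝ) ^ (2 * p)) *
        ((((p : ℝ) + 1) ^ (2 * p) * (K : ℝ) ^ (2 * p)) * N) := by gcongr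
    _ = (4 * ((p : ℝ) + 1) ^ p * M) ^ 2 * N := by
        rw [pow_mul' ((p : ℝ) + 1)]
        field_simp
        ring

theorem exists_derivative_eq (Q : ℝ[X]) : ∃ R : ℝ[X], derivative R = Q := by
  induction Q using Polynomial.induction_on' with
  | add f g hf hg =>
    obtain ⟨F, rfl⟩ := hf
    obtain ⟨G, rfl⟩ := hg
    exact ⟨F + G, derivative_add⟩
  | monomial n a =>
    refine ⟨monomial (n + 1) (a / (n + 1)), ?_⟩
    have : (n : ℝ) + 1 ≠ 0 := by positivity
    rw [derivative_monomial, Nat.add_sub_cancel]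
    push_cast
    rw [div_mul_cancel₀ _ this]

/-- Simultaneous polynomial approximation of a `C^n` function and of its `n`-th derivative. -/
theorem exists_polynomial_near_iteratedDerivWithin (n : ℕ) {g : ℝ → ℝ}
    (hg : ContDiffOn ℝ n g (Set.Icc (-1) 1)) {ε : ℝ} (hε : 0 < ε) :
    ∃ G : ℝ[X], ∀ x ∈ Set.Icc (-1 : ℝ) 1, |g x - G.eval x| ≤ ε ∧
      |iteratedDerivWithin n g (Set.Icc (-1) 1) x - (derivative^[n] G).eval x| ≤ ε := by
  have hu : UniqueDiffOn ℝ (Set.Icc (-1 : ℝ) 1) := uniqueDiffOn_Icc (by norm_num)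
  suffices H : ∀ ε > 0, ∃ G : ℝ[X], ∀ x ∈ Set.Icc (-1 : ℝ) 1, |g x - G.eval x| ≤ ε ∧
      |iteratedDerivWithin n g (Set.Icc (-1) 1) x - (derivative^[n] G).eval x| ≤ ε from H ε hε
  clear hε
  induction n generalizing g with
  | zero =>
    intro ε hε
    obtain ⟨G, hG⟩ := exists_polynomial_near_of_continuousOn (-1) 1 g hg.continuousOn ε hε
    refine ⟨G, fun x hx => ?_⟩
    have := (hG x hx).le
    rw [abs_sub_comm] at this
    simpa using this
  | succ n ih =>
    intro ε hε
    push_cast at hg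
    obtain ⟨hd, -, hc⟩ := (contDiffOn_succ_iff_derivWithin hu).1 hg
    obtain ⟨Q, hQ⟩ := ih hc (ε / 2) (half_pos hε)
    obtain ⟨R, hR⟩ := exists_derivative_eq Q
    set G := R + C (g (-1) - R.eval (-1)) with hGdef
    have hG : derivative G = Q := by simp [hGdef, hR]
    have hG1 : g (-1) - G.eval (-1) = 0 := by simp [hGdef]
    refine ⟨G, fun x hx => ⟨?_, ?_⟩⟩
    · have hmv := Convex.norm_image_sub_le_of_norm_hasDerivWithin_le
        (f := fun y => g y - G.eval y)
        (f' := fun y => derivWithin g (Set.Icc (-1) 1) y - Q.eval y)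
        (C := ε / 2) (s := Set.Icc (-1 : ℝ) 1) (x := -1) (y := x)
        (fun y hy => by
          rw [← hG]
          exact (hd y hy).hasDerivWithinAt.sub (G.hasDerivAt y).hasDerivWithinAt)
        (fun y hy => (hQ y hy).1) (convex_Icc _ _) (by simp) hx
      simp only [hG1, sub_zero, Real.norm_eq_abs] at hmv
      refine hmv.trans ?_
      have : |x - -1| ≤ 2 := abs_le.2 ⟨by linarith [hx.1], by linarith [hx.2]⟩
      nlinarith
    · rw [iteratedDerivWithin_succ', Function.iterate_succ_apply, hG]
      exact (hQ x hx).2.trans (half_le_self hε.le)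

theorem abs_partialSum_sub_le {g : ℝ → ℝ} (hg : ContinuousOn g (Set.Icc (-1) 1)) {G : ℝ[X]}
    {ε : ℝ} (hε : ∀ y ∈ Set.Icc (-1 : ℝ) 1, |g y - G.eval y| ≤ ε) (L : ℕ)
    {x : ℝ} (hx : x ∈ Set.Icc (-1 : ℝ) 1) :
    |∑ k ∈ Finset.range L, (((2 * (k : ℝ) + 1) / 2) *
          ∫ y in (-1 : ℝ)..1, g y * (legendre k).eval y) * (legendre k).eval x -
        ∑ k ∈ Finset.range L,
          ((2 * (k : ℝ) + 1) / 2 * polyIntegral (G * legendre k)) * (legendre k).eval x| ≤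
      ε * ∑ k ∈ Finset.range L, (2 * (k : ℝ) + 1) := by
  have hε0 : 0 ≤ ε := (abs_nonneg _).trans (hε x hx)
  rw [← Finset.sum_sub_distrib, Finset.mul_sum]
  refine (Finset.abs_sum_le_sum_abs _ _).trans (Finset.sum_le_sum fun k _ => ?_)
  have hI : (∫ y in (-1 : ℝ)..1, g y * (legendre k).eval y) - polyIntegral (G * legendre k) =
      ∫ y in (-1 : ℝ)..1, (g y - G.eval y) * (legendre k).eval y := by
    rw [polyIntegral_apply, ← intervalIntegral.integral_sub]
    · simp only [eval_mul, sub_mul]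
    · refine ContinuousOn.intervalIntegrable ?_
      rw [Set.uIcc_of_le (by norm_num)]
      exact hg.mul (legendre k).continuousOn
    · exact (G * legendre k).continuous.intervalIntegrable _ _
  have hbound : |∫ y in (-1 : ℝ)..1, (g y - G.eval y) * (legendre k).eval y| ≤ ε * 2 := by
    rw [show ε * 2 = ε * |(1 : ℝ) - -1| by norm_num, ← Real.norm_eq_abs]
    refine intervalIntegral.norm_integral_le_of_norm_le_const fun y hy => ?_
    rw [Set.uIoc_of_le (by norm_num)] at hy
    have hy' := Set.Ioc_subset_Icc_self hy
    rw [norm_mul]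
    exact (mul_le_mul (hε y hy') (abs_legendre_le_one k hy') (abs_nonneg _) hε0).trans_eq
      (mul_one ε)
  rw [← sub_mul, ← mul_sub, hI, abs_mul, abs_mul, abs_of_pos (by positivity)]
  calc (2 * (k : ℝ) + 1) / 2 * |∫ y in (-1 : ℝ)..1, (g y - G.eval y) * (legendre k).eval y| *
        |(legendre k).eval x|
      ≤ (2 * (k : ℝ) + 1) / 2 * (ε * 2) * 1 := by
        gcongr
        exact abs_legendre_le_one k hx
    _ = ε * (2 * (k : ℝ) + 1) := by ring

theorem fourier_legendre_convergence_rate (p : ℕ) :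
    ∃ c : ℝ, 0 < c ∧ ∀ g : ℝ → ℝ,
      ContDiffOn ℝ (p + 1) g (Set.Icc (-1) 1) →
      ∀ M : ℝ, (∀ y ∈ Set.Icc (-1:ℝ) 1,
        |iteratedDerivWithin (p + 1) g (Set.Icc (-1) 1) y| ≤ M) →
      ∀ N : ℕ, p + 1 < N →
      ∀ x ∈ Set.Icc (-1:ℝ) 1,
        |g x - ∑ k ∈ Finset.range (N + 1),
          (((2 * (k : ℝ) + 1) / 2) * ∫ y in (-1:ℝ)..1, g y * (legendre k).eval y) *
            (legendre k).eval x|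
          ≤ c * M / (N : ℝ) ^ ((p : ℝ) + 1 / 2) := by
  refine ⟨4 * ((p : ℝ) + 1) ^ p, by positivity, fun g hg M hM N hN x hx => ?_⟩
  have hN' : (0 : ℝ) < N := by exact_mod_cast (by omega : 0 < N)
  set c : ℝ := 4 * ((p : ℝ) + 1) ^ p
  set R : ℝ := (N : ℝ) ^ ((p : ℝ) + 1 / 2)
  set A : ℝ := ∑ k ∈ Finset.range (N + 1), (2 * (k : ℝ) + 1)
  have hR : 0 < R := by positivity
  have hA : 0 ≤ A := Finset.sum_nonneg fun k _ => by positivity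
  refine le_of_forall_pos_le_add fun δ hδ => ?_
  have hK : 0 < c / R + 1 + A := by positivity
  set ε := δ / (c / R + 1 + A)
  obtain ⟨G, hG⟩ := exists_polynomial_near_iteratedDerivWithin (p + 1)
    (by exact_mod_cast hg) (div_pos hδ hK : 0 < ε)
  have hGM : ∀ y ∈ Set.Icc (-1 : ℝ) 1, |(derivative^[p + 1] G).eval y| ≤ M + ε := fun y hy => by
    have h1 := abs_le.1 (hG y hy).2
    have h2 := abs_le.1 (hM y hy)
    exact abs_le.2 ⟨by linarith, by linarith⟩
  have h1 := abs_le.1 (abs_eval_sub_partialSum_le hN hGM hx)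
  have h2 := abs_le.1 (abs_partialSum_sub_le hg.continuousOn (fun y hy => (hG y hy).1) (N + 1) hx)
  have h3 := abs_le.1 (hG x hx).1
  have h4 : c * (M + ε) / R + ε + ε * A = c * M / R + δ := by
    have : ε * (c / R + 1 + A) = δ := div_mul_cancel₀ _ hK.ne'
    rw [← this]
    ring
  rw [← h4]
  exact abs_le.2 ⟨by linarith, by linarith⟩
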